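/- Let K be an algebraically closed field, L/K a field extension of transcendence degree d ≥ 1, and v a discrete valuation on L trivial on K whose residue field has transcendence degree d−1 over K. Then for every f ∈ L^×: f ∈ K if and only if v'(f) = 0 for every discrete valuation v' on L that is trivial on K and has residue field of transcendence degree d−1 over K. -/

import Mathlib

open Valuation

/-- The ring homomorphism `K → 𝒪ᵥ` into the valuation subring of a valuation on
`L` which is trivial on `K`. -/
noncomputable def toValSubring {K L : Type*} [Field K] [Field L] [Algebra K L]
    (v : Valuation L (WithZero (Multiplicative ℤ)))
    (triv : ∀ c : K, c ≠ 0 → v (algebraMap K L c) = 1) :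
    K →+* ↥v.valuationSubring where
  toFun c := ⟨algebraMap K L c, by
    rw [Valuation.mem_valuationSubring_iff]
    rcases eq_or_ne c 0 with h | h
    · simp [h]
    · exact le_of_eq (triv c h)⟩
  map_one' := Subtype.ext (map_one _)
  map_mul' x y := Subtype.ext (map_mul _ _ _)
  map_zero' := Subtype.ext (map_zero _)
  map_add' x y := Subtype.ext (map_add _ _ _)

/-- The induced map from `K` to the residue field of a valuation trivial on `K`. -/
noncomputable def toResidue {K L : Type*} [Field K] [Field L] [Algebra K L]
    (v : Valuation L (WithZero (Multiplicative ℤ)))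
    (triv : ∀ c : K, c ≠ 0 → v (algebraMap K L c) = 1) :
    K →+* IsLocalRing.ResidueField ↥v.valuationSubring :=
  (IsLocalRing.residue _).comp (toValSubring v triv)

/-- A member of `Reg(L/K)` (for `L/K` of transcendence degree `d`): a normalized
discrete valuation on `L` (value group `ℤ`, written multiplicatively, with `0`
adjoined), trivial on `K`, whose residue field has transcendence degree `d − 1`
over `K`. -/
structure RegVal (K L : Type*) [Field K] [Field L] [Algebra K L] (d : ℕ) where
  v : Valuation L (WithZero (Multiplicative ℤ))
  surj : Function.Surjective v
  triv : ∀ c : K, c ≠ 0 → v (algebraMap K L c) = 1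
  res_trdeg : ∃ y : Fin (d - 1) → IsLocalRing.ResidueField ↥v.valuationSubring,
    letI := (toResidue v triv).toAlgebra
    IsTranscendenceBasis K y

open Polynomial

lemma aux_cyclic (G : Type*) [CommGroup G] [LinearOrder G] [IsOrderedMonoid G] [Nontrivial G]
    [IsCyclic G] : Nonempty (G ≃*o Multiplicative ℤ) := by
  obtain ⟨g, hg1, hg⟩ : ∃ g : G, 1 < g ∧ ∀ x : G, ∃ n : ℤ, g ^ n = x := by
    obtain ⟨g, hg⟩ := IsCyclic.exists_generator (α := G)
    obtain h | h | h := lt_trichotomy g 1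
    · refine ⟨g⁻¹, by simpa using h, fun x => ?_⟩
      obtain ⟨n, hn⟩ := Subgroup.mem_zpowers_iff.1 (hg x)
      exact ⟨-n, by simpa using hn⟩
    · exfalso
      obtain ⟨x, hx⟩ := exists_ne (1 : G)
      obtain ⟨n, hn⟩ := Subgroup.mem_zpowers_iff.1 (hg x)
      apply hx
      rw [← hn, h, one_zpow]
    · exact ⟨g, h, fun x => Subgroup.mem_zpowers_iff.1 (hg x)⟩
  have hm : StrictMono (fun n : ℤ => g ^ n) := zpow_right_strictMono hg1
  let e : Multiplicative ℤ ≃* G := MulEquiv.ofBijective (zpowersHom G g)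
    ⟨fun a b h => by
      have : g ^ (Multiplicative.toAdd a) = g ^ (Multiplicative.toAdd b) := by
        simpa using h
      exact Multiplicative.toAdd.injective (hm.injective this),
     fun x => by
      obtain ⟨n, hn⟩ := hg x
      exact ⟨Multiplicative.ofAdd n, by simpa using hn⟩⟩
  let e' : Multiplicative ℤ ≃*o G := ⟨e, by
    intro a b
    have : g ^ (Multiplicative.toAdd a) ≤ g ^ (Multiplicative.toAdd b) ↔ _ := hm.le_iff_le
    exact this⟩
  exact ⟨e'.symm⟩

section core
variable {k L Γ₀ : Type*} [Field k] [Field L] [Algebra k L] [LinearOrderedCommGroupWithZero Γ₀]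

lemma aux_le_one (v : Valuation L Γ₀) (hk : ∀ c : k, c ≠ 0 → v (algebraMap k L c) = 1)
    (f : L) (hf1 : v f < 1) (p : k[X]) : v (aeval f p) ≤ 1 := by
  rw [aeval_eq_sum_range]
  refine v.map_sum_le fun i _ => ?_
  rw [Algebra.smul_def, map_mul, map_pow]
  refine mul_le_one' ?_ (pow_le_one' hf1.le _)
  rcases eq_or_ne (p.coeff i) 0 with h | h
  · simp [h]
  · exact (hk _ h).le

lemma aux_val (v : Valuation L Γ₀) (hk : ∀ c : k, c ≠ 0 → v (algebraMap k L c) = 1)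
    (f : L) (hf1 : v f < 1) (p : k[X]) (hp : p ≠ 0) :
    ∃ n : ℕ, v (aeval f p) = v f ^ n := by
  obtain ⟨q, hq, hnd⟩ := (Polynomial.finiteMultiplicity_X_sub_C (0 : k) hp).exists_eq_pow_mul_and_not_dvd
  rw [C_0, sub_zero] at hq hnd
  refine ⟨multiplicity X p, ?_⟩
  · nth_rewrite 1 [hq]
    rw [map_mul, map_mul, map_pow, map_pow, aeval_X]
    rw [X_dvd_iff] at hnd
    have : v (aeval f q) = 1 := by
      rw [← X_mul_divX_add q]
      simp only [map_add, map_mul, aeval_X, aeval_C]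
      rw [v.map_add_eq_of_lt_right]
      · exact hk _ hnd
      · rw [hk _ hnd, map_mul]
        exact mul_lt_one_of_lt_of_le hf1 (aux_le_one v hk f hf1 _)
    rw [this, mul_one]

lemma aux_two (v : Valuation L Γ₀) (s : Finset ℕ) (t : ℕ → L) (hs : s.Nonempty)
    (h0 : ∀ i ∈ s, t i ≠ 0) (hsum : ∑ i ∈ s, t i = 0) :
    ∃ i ∈ s, ∃ j ∈ s, i < j ∧ v (t i) = v (t j) := by
  by_contra! H
  obtain ⟨m, hm, hmax⟩ := s.exists_max_image (fun i => v (t i)) hs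
  have hlt : ∀ i ∈ s.erase m, v (t i) < v (t m) := by
    intro i hi
    rw [Finset.mem_erase] at hi
    refine lt_of_le_of_ne (hmax i hi.2) fun h => ?_
    rcases lt_or_gt_of_ne hi.1 with h' | h'
    · exact H i hi.2 m hm h' h
    · exact H m hm i hi.2 h' h.symm
  have h1 : v (∑ i ∈ s.erase m, t i) < v (t m) :=
    v.map_sum_lt (by simpa using h0 m hm) hlt
  rw [← Finset.add_sum_erase _ _ hm] at hsum
  rw [eq_neg_of_add_eq_zero_right hsum, Valuation.map_neg] at h1
  exact lt_irrefl _ h1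

open IntermediateField in
lemma aux_field (v : Valuation L Γ₀) (hk : ∀ c : k, c ≠ 0 → v (algebraMap k L c) = 1)
    (f : L) (hf0 : f ≠ 0) (hf1 : v f < 1) (a : L) (ha : a ∈ k⟮f⟯) (ha0 : a ≠ 0) :
    ∃ n : ℤ, v a = v f ^ n := by
  obtain ⟨r, s, rfl⟩ := (IntermediateField.mem_adjoin_simple_iff k a).1 ha
  have hr : r ≠ 0 := by rintro rfl; simp at ha0
  have hs : s ≠ 0 := by rintro rfl; simp at ha0
  obtain ⟨n, hn⟩ := aux_val v hk f hf1 r hr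
  obtain ⟨m, hm⟩ := aux_val v hk f hf1 s hs
  refine ⟨n - m, ?_⟩
  rw [map_div₀, hn, hm, zpow_sub₀ (by simpa using hf0)]
  simp

open IntermediateField in
lemma aux_pow (v : Valuation L Γ₀) (hk : ∀ c : k, c ≠ 0 → v (algebraMap k L c) = 1)
    (f : L) (hf0 : f ≠ 0) (hf1 : v f < 1) [FiniteDimensional k⟮f⟯ L] (y : L) (hy : y ≠ 0) :
    ∃ n : ℤ, v y ^ (Module.finrank k⟮f⟯ L).factorial = v f ^ n := by
  have hint : IsIntegral k⟮f⟯ y := Algebra.IsIntegral.isIntegral y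
  set p := minpoly k⟮f⟯ y with hp
  have hp0 : p ≠ 0 := minpoly.ne_zero hint
  have hdeg : p.natDegree ≤ Module.finrank k⟮f⟯ L := minpoly.natDegree_le y
  have hsum : ∑ i ∈ p.support, (p.coeff i : L) * y ^ i = 0 := by
    have := minpoly.aeval k⟮f⟯ y
    rw [← hp, aeval_def, eval₂_eq_sum, Polynomial.sum] at this
    exact this
  have hne : ∀ i ∈ p.support, (p.coeff i : L) ≠ 0 := fun i hi => by
    simpa using hi
  obtain ⟨i, hi, j, hj, hij, hv⟩ := aux_two v p.support _ (by simpa using hp0)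
    (fun i hi => mul_ne_zero (hne i hi) (pow_ne_zero _ hy)) hsum
  obtain ⟨a, ha⟩ := aux_field v hk f hf0 hf1 _ (p.coeff i).2 (hne i hi)
  obtain ⟨b, hb⟩ := aux_field v hk f hf0 hf1 _ (p.coeff j).2 (hne j hj)
  have hvf : v f ≠ 0 := by simpa using hf0
  have hvy : v y ≠ 0 := by simpa using hy
  obtain ⟨e, rfl⟩ := Nat.exists_eq_add_of_lt hij
  have hdvd : (e + 1) ∣ (Module.finrank k⟮f⟯ L).factorial := by
    refine Nat.dvd_factorial (by omega) ?_
    have := le_natDegree_of_mem_supp _ hj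
    omega
  obtain ⟨c, hc⟩ := hdvd
  have key : v y ^ (e + 1) = v f ^ (a - b) := by
    rw [map_mul, map_mul, map_pow, map_pow, ha, hb] at hv
    rw [zpow_sub₀ hvf, eq_div_iff (zpow_ne_zero _ hvf)]
    have h2 : v y ^ i ≠ 0 := pow_ne_zero _ hvy
    apply mul_right_cancel₀ h2
    rw [hv, mul_right_comm, ← pow_add, mul_comm]
    congr 2
    omega
  refine ⟨(a - b) * c, ?_⟩
  rw [hc, pow_mul, key, zpow_mul]
  simp

end core

lemma aux_res_alg {k L : Type*} [Field k] [Field L] [Algebra k L]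
    (v : Valuation L (WithZero (Multiplicative ℤ)))
    (hk : ∀ c : k, c ≠ 0 → v (algebraMap k L c) = 1)
    (f : L) (hf0 : f ≠ 0) (hf1 : v f < 1) (halg : Algebra.IsAlgebraic (Algebra.adjoin k {f}) L)
    (z : IsLocalRing.ResidueField v.valuationSubring) :
    letI := (toResidue v hk).toAlgebra
    IsAlgebraic k z := by
  let := (toResidue v hk).toAlgebra
  obtain ⟨y, rfl⟩ := IsLocalRing.residue_surjective z
  obtain ⟨p, hp0, hp⟩ := halg.isAlgebraic (y : L)
  have hmem : f ∈ Algebra.adjoin k {f} := Algebra.subset_adjoin rfl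
  let φ : k[X] →ₐ[k] Algebra.adjoin k {f} := aeval ⟨f, hmem⟩
  have hφ : ∀ a, ((φ a : Algebra.adjoin k {f}) : L) = aeval f a := fun a => by
    have := aeval_algebraMap_apply L (⟨f, hmem⟩ : Algebra.adjoin k {f}) a
    exact this.symm
  have hsurj : Function.Surjective φ := by
    rintro ⟨a, ha⟩
    have ha' := ha
    rw [Algebra.adjoin_singleton_eq_range_aeval] at ha'
    obtain ⟨q, hq⟩ := ha'
    exact ⟨q, Subtype.ext ((hφ q).trans hq)⟩
  obtain ⟨P, hP⟩ := Polynomial.map_surjective φ.toRingHom hsurj p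
  have hP0 : P ≠ 0 := by rintro rfl; apply hp0; rw [← hP, Polynomial.map_zero]
  have hev : P.eval₂ (aeval f : k[X] →ₐ[k] L).toRingHom (y : L) = 0 := by
    rw [← hP, aeval_def, eval₂_map] at hp
    have hc : (algebraMap (Algebra.adjoin k {f}) L).comp φ.toRingHom
        = (aeval f : k[X] →ₐ[k] L).toRingHom := RingHom.ext hφ
    rw [hc] at hp
    exact hp
  have hCX : ¬ IsUnit (C X : k[X][X]) := by
    rw [isUnit_C]; exact not_isUnit_X
  obtain ⟨n, Q, hQ, rfl⟩ : ∃ n : ℕ, ∃ Q : k[X][X], ¬ (C X : k[X][X]) ∣ Q ∧ P = C X ^ n * Q := by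
    have := (FiniteMultiplicity.of_not_isUnit hCX hP0).exists_eq_pow_mul_and_not_dvd
    obtain ⟨Q, h1, h2⟩ := this
    exact ⟨_, Q, h2, h1⟩
  have hev' : Q.eval₂ (aeval f : k[X] →ₐ[k] L).toRingHom (y : L) = 0 := by
    rw [eval₂_mul, eval₂_pow, eval₂_C] at hev
    refine (mul_eq_zero.1 hev).resolve_left (pow_ne_zero _ ?_)
    simpa using hf0
  have hfO : f ∈ v.valuationSubring := by
    rw [Valuation.mem_valuationSubring_iff]; exact hf1.le
  let θ : k[X] →+* v.valuationSubring := eval₂RingHom (toValSubring v hk) ⟨f, hfO⟩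
  have h1 : (v.valuationSubring.subtype).comp θ = (aeval f : k[X] →ₐ[k] L).toRingHom := by
    ext a
    · simp [θ, toValSubring]
    · simp [θ]
  have hres : IsLocalRing.residue v.valuationSubring ⟨f, hfO⟩ = 0 := by
    rw [IsLocalRing.residue_eq_zero_iff, IsLocalRing.mem_maximalIdeal, mem_nonunits_iff,
      isUnit_iff_exists_inv]
    rintro ⟨⟨g, hg⟩, h⟩
    have h' : f * g = 1 := congrArg Subtype.val h
    rw [Valuation.mem_valuationSubring_iff] at hg
    have := mul_lt_one_of_lt_of_le hf1 hg
    rw [← map_mul, h', map_one] at this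
    exact lt_irrefl _ this
  have h2 : (IsLocalRing.residue v.valuationSubring).comp θ
      = (toResidue v hk).comp (evalRingHom 0) := by
    ext a
    · simp [θ, toResidue]
    · simp [θ, hres]
  have h3 : Q.eval₂ θ y = 0 := by
    apply Subtype.val_injective
    have := hom_eval₂ Q θ v.valuationSubring.subtype y
    rw [h1] at this
    exact this.trans hev'
  refine ⟨Q.map (evalRingHom 0), ?_, ?_⟩
  · intro h
    apply hQ
    rw [C_dvd_iff_dvd_coeff]
    intro i
    rw [X_dvd_iff, coeff_zero_eq_eval_zero]
    have := congrArg (fun q => q.coeff i) h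
    simpa using this
  · rw [aeval_def, eval₂_map]
    have := hom_eval₂ Q θ (IsLocalRing.residue v.valuationSubring) y
    rw [h2, h3, map_zero] at this
    exact this.symm

open IntermediateField in
lemma aux_exists_val {k L : Type*} [Field k] [Field L] [Algebra k L] (f : L)
    (htr : Transcendental k f) [FiniteDimensional k⟮f⟯ L] :
    ∃ v : Valuation L (WithZero (Multiplicative ℤ)), Function.Surjective v ∧
      (∀ c : k, c ≠ 0 → v (algebraMap k L c) = 1) ∧ v f < 1 := by
  have hf0 : f ≠ 0 := by
    rintro rfl
    exact htr isAlgebraic_zero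
  have hmem : f ∈ (Algebra.adjoin k {f}).toSubring := Algebra.subset_adjoin (Set.mem_singleton f)
  let I : Ideal (Algebra.adjoin k {f}).toSubring := Ideal.span {⟨f, hmem⟩}
  have hI : I ≠ ⊤ := by
    rw [Ne, Ideal.eq_top_iff_one, Ideal.mem_span_singleton]
    rintro ⟨⟨g, hg⟩, h⟩
    have h' : 1 = f * g := congrArg Subtype.val h
    have hg' : g ∈ Algebra.adjoin k {f} := hg
    rw [Algebra.adjoin_singleton_eq_range_aeval] at hg'
    obtain ⟨q, rfl⟩ := hg'
    apply htr
    refine ⟨X * q - 1, ?_, ?_⟩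
    · intro h0
      have := congrArg (eval 0) h0
      simp at this
    · rw [_root_.map_sub, map_mul, aeval_X, map_one, sub_eq_zero]
      exact h'.symm
  obtain ⟨B, hB, hBI⟩ := Ideal.image_subset_nonunits_valuationSubring I hI
  have hf1 : B.valuation f < 1 := by
    have : f ∈ B.nonunits := hBI ⟨⟨f, hmem⟩, Ideal.subset_span rfl, rfl⟩
    exact this
  have hk : ∀ c : k, c ≠ 0 → B.valuation (algebraMap k L c) = 1 := by
    have hle : ∀ c : k, B.valuation (algebraMap k L c) ≤ 1 := fun c => by
      rw [ValuationSubring.valuation_le_one_iff]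
      exact hB ((Algebra.adjoin k {f}).algebraMap_mem c)
    intro c hc
    refine le_antisymm (hle c) ?_
    have := hle c⁻¹
    rw [map_inv₀, map_inv₀] at this
    have h0 : 0 < B.valuation (algebraMap k L c) := by
      rw [zero_lt_iff]; simpa using hc
    exact (inv_le_one₀ h0).1 this
  set N := (Module.finrank k⟮f⟯ L).factorial with hN
  have hN0 : N ≠ 0 := Nat.factorial_ne_zero _
  have hvf : B.valuation f ≠ 0 := by simpa using hf0
  let u : B.ValueGroupˣ := Units.mk0 _ hvf
  have hu : ∀ g : B.ValueGroupˣ, g ^ N ∈ Subgroup.zpowers u := by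
    intro g
    obtain ⟨y, hy⟩ := B.valuation_surjective (g : B.ValueGroup)
    have hy0 : y ≠ 0 := by
      rintro rfl
      rw [map_zero] at hy
      exact g.ne_zero hy.symm
    obtain ⟨n, hn⟩ := aux_pow B.valuation hk f hf0 hf1 y hy0
    refine ⟨n, ?_⟩
    ext
    push_cast
    rw [← hy, hN, hn]
    simp [u]
  have : Nontrivial B.ValueGroupˣ := ⟨u, 1, fun h => hf1.ne (congrArg Units.val h)⟩
  have : IsCyclic B.ValueGroupˣ := by
    let φ : B.ValueGroupˣ →* Subgroup.zpowers u := (powMonoidHom N).codRestrict _ hu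
    refine isCyclic_of_injective φ fun a b h => ?_
    have h' : a ^ N = b ^ N := congrArg Subtype.val h
    exact pow_left_injective hN0 h'
  classical
  obtain ⟨e⟩ := aux_cyclic B.ValueGroupˣ
  let E : B.ValueGroup ≃*o WithZero (Multiplicative ℤ) :=
    OrderMonoidIso.withZeroUnits.symm.trans e.withZero
  let E' : B.ValueGroup →*₀ WithZero (Multiplicative ℤ) :=
    { toFun := E, map_zero' := map_zero E, map_one' := map_one E, map_mul' := map_mul E }
  have hmono : StrictMono E' := E.strictMono
  refine ⟨B.valuation.map E' hmono.monotone, ?_, ?_, ?_⟩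
  · exact E.surjective.comp B.valuation_surjective
  · intro c hc
    rw [Valuation.map_apply, hk c hc, map_one]
  · rw [Valuation.map_apply, ← map_one E']
    exact hmono hf1

open IntermediateField in
lemma aux_main {K L : Type*} [Field K] [Field L] [Algebra K L]
    (d : ℕ)
    (hfg : ∃ s : Finset L, IntermediateField.adjoin K (s : Set L) = ⊤)
    (htr : ∃ x : Fin d → L, IsTranscendenceBasis K x)
    (f : L) (hf : Transcendental K f) : ∃ w : RegVal K L d, w.v f ≠ 1 := by
  have hf0 : f ≠ 0 := by
    rintro rfl
    exact hf isAlgebraic_zero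
  obtain ⟨s, hfs, hs⟩ := exists_isTranscendenceBasis_superset (R := K) (s := {f})
    ((algebraicIndependent_singleton_iff (⟨f, rfl⟩ : ({f} : Set L))).2 hf)
  obtain ⟨x0, hx0⟩ := htr
  have hcard := hs.lift_cardinalMk_eq hx0
  let s0 : Set L := s \ {f}
  have hins : insert f s0 = s := by
    simp only [s0, Set.insert_sdiff_singleton]
    exact Set.insert_eq_of_mem (hfs rfl)
  have hfs0 : f ∉ s0 := by simp [s0]
  have hfin : Nonempty (Fin (d - 1) ≃ s0) := by
    rw [Cardinal.mk_fin, Cardinal.lift_natCast, Cardinal.lift_eq_nat_iff] at hcard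
    have hsf : s.Finite := by
      rw [← Cardinal.lt_aleph0_iff_set_finite, hcard]; exact Cardinal.natCast_lt_aleph0
    have hnc : s.ncard = d := by
      rw [← Nat.card_coe_set_eq, Nat.card, hcard]; simp
    have h0 : s0.ncard = d - 1 := by
      rw [← hnc]; exact Set.ncard_sdiff_singleton_of_mem (hfs rfl)
    have : Finite s0 := hsf.subset Set.sdiff_subset
    rw [← Nat.card_coe_set_eq] at h0
    exact ⟨(Finite.equivFinOfCardEq h0).symm⟩
  obtain ⟨ε⟩ := hfin
  have hind : AlgebraicIndepOn K id (insert f s0) := by rw [hins]; exact hs.1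
  rw [AlgebraicIndepOn.insert_iff hfs0, Set.image_id] at hind
  obtain ⟨hind0, htrf⟩ := hind
  let k : IntermediateField K L := IntermediateField.adjoin K s0
  have htrk : Transcendental k f := IntermediateField.transcendental_adjoin_iff.2 htrf
  -- basis of k
  let x : s0 → k := fun i => ⟨i, IntermediateField.subset_adjoin K s0 i.2⟩
  have hx : IsTranscendenceBasis K x := by
    have h1 : AlgebraicIndependent K x := AlgebraicIndependent.of_comp k.val hind0
    rw [h1.isTranscendenceBasis_iff_isAlgebraic, ← IntermediateField.isAlgebraic_adjoin_iff_top]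
    have htop : IntermediateField.adjoin K (Set.range x) = ⊤ := by
      rw [← IntermediateField.lift_inj, IntermediateField.lift_adjoin, IntermediateField.lift_top]
      have : Subtype.val '' Set.range x = s0 := by
        rw [← Set.range_comp]
        exact Subtype.range_val
      rw [this]
    constructor
    intro y
    have hy : y ∈ IntermediateField.adjoin K (Set.range x) := by rw [htop]; trivial
    exact isAlgebraic_algebraMap (⟨y, hy⟩ : IntermediateField.adjoin K (Set.range x))
  have halgF : Algebra.IsAlgebraic k⟮f⟯ L := by
    have h1 := hs.isAlgebraic_field
    rw [Subtype.range_val] at h1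
    have hle : IntermediateField.adjoin K s ≤ k⟮f⟯.restrictScalars K := by
      rw [IntermediateField.adjoin_adjoin_left, Set.union_singleton, hins]
    let φ : IntermediateField.adjoin K s →+* k⟮f⟯ :=
      { toFun := fun y => ⟨y, hle y.2⟩
        map_one' := rfl
        map_zero' := rfl
        map_add' := fun _ _ => rfl
        map_mul' := fun _ _ => rfl }
    let := φ.toAlgebra
    have : IsScalarTower (IntermediateField.adjoin K s) k⟮f⟯ L :=
      IsScalarTower.of_algebraMap_eq fun _ => rfl
    exact Algebra.IsAlgebraic.tower_top (K := IntermediateField.adjoin K s) k⟮f⟯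
  have hfd : FiniteDimensional k⟮f⟯ L := by
    obtain ⟨t, ht⟩ := hfg
    have h1 : FiniteDimensional k⟮f⟯ (IntermediateField.adjoin k⟮f⟯ (t : Set L)) :=
      IntermediateField.finiteDimensional_adjoin
        fun y _ => (Algebra.IsAlgebraic.isAlgebraic y).isIntegral
    have h2 : IntermediateField.adjoin k⟮f⟯ (t : Set L) = ⊤ :=
      IntermediateField.adjoin_eq_top_of_adjoin_eq_top k (IntermediateField.adjoin_eq_top_of_adjoin_eq_top K ht)
    rw [h2] at h1
    exact (IntermediateField.topEquiv (F := k⟮f⟯) (E := L)).toLinearEquiv.finiteDimensional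
  obtain ⟨v, hsurj, hk, hv1⟩ := aux_exists_val f htrk
  have htriv : ∀ c : K, c ≠ 0 → v (algebraMap K L c) = 1 := fun c hc =>
    hk (algebraMap K k c) (by simpa using hc)
  refine ⟨⟨v, hsurj, htriv, ?_⟩, hv1.ne⟩
  let i1 := (toResidue v htriv).toAlgebra
  let i2 := (toResidue v hk).toAlgebra
  have : IsScalarTower K k (IsLocalRing.ResidueField v.valuationSubring) :=
    IsScalarTower.of_algebraMap_eq fun _ => rfl
  have : Algebra.IsAlgebraic k (IsLocalRing.ResidueField v.valuationSubring) :=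
    ⟨fun z => aux_res_alg v hk f hf0 hv1 (IntermediateField.isAlgebraic_adjoin_iff_top.1 halgF) z⟩
  have hB := hx.algebraMap_comp (A := IsLocalRing.ResidueField v.valuationSubring)
  exact ⟨_, hB.comp_equiv ε⟩

/-- Let `K` be algebraically closed, `L/K` a finitely generated
field extension of transcendence degree `d ≥ 1` admitting a discrete valuation
trivial on `K` with residue field of transcendence degree `d − 1` over `K`
(i.e. `Reg(L/K) ≠ ∅`).  Then for every `f ∈ L^×`: `f ∈ K` iff `v'(f) = 0`
(multiplicatively, `v'(f) = 1`) for every `v' ∈ Reg(L/K)`. -/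
theorem stmt4 {K L : Type*} [Field K] [Field L] [Algebra K L] [IsAlgClosed K]
    (d : ℕ) (hd : 1 ≤ d)
    (hfg : ∃ s : Finset L, IntermediateField.adjoin K (s : Set L) = ⊤)
    (htr : ∃ x : Fin d → L, IsTranscendenceBasis K x)
    (hne : Nonempty (RegVal K L d))
    (f : L) (hf : f ≠ 0) :
    f ∈ (algebraMap K L).range ↔ ∀ w : RegVal K L d, w.v f = 1 := by
  constructor
  · rintro ⟨c, rfl⟩ w
    exact w.triv c (by rintro rfl; simp at hf)
  · intro h
    by_contra hn
    have htrf : Transcendental K f := by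
      intro halg
      apply hn
      exact minpoly.mem_range_of_degree_eq_one K f
        (IsAlgClosed.degree_eq_one_of_irreducible K (minpoly.irreducible halg.isIntegral))
    obtain ⟨w, hw⟩ := aux_main d hfg htr f htrf
    exact hw (h w)
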